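/- For all τ in the complex upper half-plane ℍ and all z ∈ ℂ, one has (1/12)·φ_{0,1}(τ,z) − Λ_2(τ/2)·φ_{-2,1}(τ,z) = ϑ_4(τ,z)²/ϑ_4(τ,0)². -/

import Mathlib

noncomputable section

open Complex

/-- `2πi`. -/
def twoPiI : ℂ := 2 * Real.pi * Complex.I

/-- `q = e^{2πiτ}`. -/
def qq (τ : ℂ) : ℂ := Complex.exp (twoPiI * τ)

/-- `y = e^{2πiz}`. -/
def yy (z : ℂ) : ℂ := Complex.exp (twoPiI * z)

/-- Jacobi theta function `ϑ₁`. -/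
def th1 (τ z : ℂ) : ℂ :=
  -Complex.I * ∑' n : ℤ, (-1 : ℂ) ^ n *
    Complex.exp (twoPiI * (((n : ℂ) + 1/2) * z + ((n : ℂ) + 1/2) ^ 2 / 2 * τ))

/-- Jacobi theta function `ϑ₂`. -/
def th2 (τ z : ℂ) : ℂ :=
  ∑' n : ℤ, Complex.exp (twoPiI * (((n : ℂ) + 1/2) * z + ((n : ℂ) + 1/2) ^ 2 / 2 * τ))

/-- Jacobi theta function `ϑ₃`. -/
def th3 (τ z : ℂ) : ℂ :=
  ∑' n : ℤ, Complex.exp (twoPiI * ((n : ℂ) * z + (n : ℂ) ^ 2 / 2 * τ))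

/-- Jacobi theta function `ϑ₄`. -/
def th4 (τ z : ℂ) : ℂ :=
  ∑' n : ℤ, (-1 : ℂ) ^ n * Complex.exp (twoPiI * ((n : ℂ) * z + (n : ℂ) ^ 2 / 2 * τ))

/-- The Dedekind eta function `η(τ) = q^{1/24} ∏_{n≥1} (1 - qⁿ)`. -/
def etaF (τ : ℂ) : ℂ :=
  Complex.exp (twoPiI * τ / 24) * ∏' n : ℕ, (1 - qq τ ^ (n + 1))

/-- The quasimodular Eisenstein series `E₂(τ) = 1 - 24 ∑_{n≥1} σ₁(n) qⁿ`. -/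
def E2 (τ : ℂ) : ℂ :=
  1 - 24 * ∑' n : ℕ, (∑ d ∈ Nat.divisors (n + 1), (d : ℂ)) * qq τ ^ (n + 1)

/-- `Λ_N(τ) = (N/24)(N E₂(Nτ) - E₂(τ))`. -/
def Lam (N : ℕ) (τ : ℂ) : ℂ := (N : ℂ) / 24 * ((N : ℂ) * E2 ((N : ℂ) * τ) - E2 τ)

/-- The weak Jacobi form `φ_{0,1}`. -/
def phi01 (τ z : ℂ) : ℂ :=
  4 * (th2 τ z ^ 2 / th2 τ 0 ^ 2 + th3 τ z ^ 2 / th3 τ 0 ^ 2 + th4 τ z ^ 2 / th4 τ 0 ^ 2)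

/-- The weak Jacobi form `φ_{-2,1}`. -/
def phim21 (τ z : ℂ) : ℂ := -(th1 τ z ^ 2) / etaF τ ^ 6

/-! ### The theta functions in terms of `jacobiTheta₂` -/

lemma exp_int_mul_pi_mul_I (n : ℤ) : Complex.exp (n * (Real.pi * I)) = (-1) ^ n := by
  rw [exp_int_mul, exp_pi_mul_I]

lemma th3_eq (τ z : ℂ) : th3 τ z = jacobiTheta₂ z τ := by
  refine tsum_congr fun n => ?_
  rw [jacobiTheta₂_term, twoPiI]
  congr 1
  ring

lemma th4_eq (τ z : ℂ) : th4 τ z = jacobiTheta₂ (z + 1 / 2) τ := by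
  refine tsum_congr fun n => ?_
  rw [jacobiTheta₂_term, twoPiI, ← exp_int_mul_pi_mul_I, ← Complex.exp_add]
  congr 1
  ring

lemma th2_eq (τ z : ℂ) :
    th2 τ z = Complex.exp (Real.pi * I * (τ / 4 + z)) * jacobiTheta₂ (z + τ / 2) τ := by
  rw [th2, jacobiTheta₂, ← tsum_mul_left]
  refine tsum_congr fun n => ?_
  rw [jacobiTheta₂_term, twoPiI, ← Complex.exp_add]
  congr 1
  ring

lemma th1_eq (τ z : ℂ) :
    th1 τ z = -I * (Complex.exp (Real.pi * I * (τ / 4 + z)) *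
      jacobiTheta₂ (z + 1 / 2 + τ / 2) τ) := by
  rw [th1]
  congr 1
  rw [jacobiTheta₂, ← tsum_mul_left]
  refine tsum_congr fun n => ?_
  rw [jacobiTheta₂_term, twoPiI, ← exp_int_mul_pi_mul_I, ← Complex.exp_add, ← Complex.exp_add]
  congr 1
  ring

/-! ### Squares of theta functions -/

/-- A pair of integers is, in a unique way, of the form `(k + l, k - l)` or `(k + l + 1, k - l)`. -/
def sumDiffEquiv : (ℤ × ℤ) ⊕ (ℤ × ℤ) ≃ ℤ × ℤ :=
  Equiv.ofBijective
    (Sum.elim (fun p => (p.1 + p.2, p.1 - p.2)) (fun p => (p.1 + p.2 + 1, p.1 - p.2))) <| by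
    constructor
    · rintro (⟨a, b⟩ | ⟨a, b⟩) (⟨c, d⟩ | ⟨c, d⟩) h <;>
        simp only [Sum.elim_inl, Sum.elim_inr, Prod.mk.injEq, Sum.inl.injEq, Sum.inr.injEq,
          reduceCtorEq] at h ⊢ <;> omega
    · rintro ⟨m, n⟩
      rcases Int.even_or_odd' (m + n) with ⟨k, hk | hk⟩
      · exact ⟨Sum.inl (k, k - n), Prod.ext (by simp; omega) (by simp)⟩
      · exact ⟨Sum.inr (k, k - n), Prod.ext (by simp; omega) (by simp)⟩

lemma sumDiffEquiv_inl (p : ℤ × ℤ) : sumDiffEquiv (Sum.inl p) = (p.1 + p.2, p.1 - p.2) := rfl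

lemma sumDiffEquiv_inr (p : ℤ × ℤ) : sumDiffEquiv (Sum.inr p) = (p.1 + p.2 + 1, p.1 - p.2) := rfl

lemma hasSum_mul_of_hasSum {f g : ℤ → ℂ} {s t : ℂ} (hf : HasSum f s) (hg : HasSum g t) :
    HasSum (fun p : ℤ × ℤ => f p.1 * g p.2) (s * t) :=
  hf.mul hg (summable_mul_of_summable_norm hf.summable.norm hg.summable.norm)

lemma hasSum_jacobiTheta₂_mul (x w : ℂ) {τ : ℂ} (hτ : 0 < τ.im) :
    HasSum (fun p : ℤ × ℤ => jacobiTheta₂_term p.1 x τ * jacobiTheta₂_term p.2 w τ)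
      (jacobiTheta₂ x τ * jacobiTheta₂ w τ) :=
  hasSum_mul_of_hasSum (f := fun n => jacobiTheta₂_term n x τ)
    (g := fun n => jacobiTheta₂_term n w τ)
    (hasSum_jacobiTheta₂_term x hτ) (hasSum_jacobiTheta₂_term w hτ)

/-- The addition formula for products of two theta functions. -/
lemma jacobiTheta₂_mul_jacobiTheta₂ (x w : ℂ) {τ : ℂ} (hτ : 0 < τ.im) :
    jacobiTheta₂ x τ * jacobiTheta₂ w τ =
      jacobiTheta₂ (x + w) (2 * τ) * jacobiTheta₂ (x - w) (2 * τ) +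
      Complex.exp (Real.pi * I * (2 * x + τ)) *
        (jacobiTheta₂ (x + w + τ) (2 * τ) * jacobiTheta₂ (x - w + τ) (2 * τ)) := by
  have h2 : 0 < (2 * τ).im := by simpa using hτ
  refine (sumDiffEquiv.hasSum_iff.mpr (hasSum_jacobiTheta₂_mul x w hτ)).unique
    (HasSum.sum ?_ ?_)
  · refine (hasSum_jacobiTheta₂_mul (x + w) (x - w) h2).congr_fun fun p => ?_
    simp only [Function.comp_apply, sumDiffEquiv_inl,
      jacobiTheta₂_term, ← Complex.exp_add]
    congr 1
    push_cast
    ring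
  · refine ((hasSum_jacobiTheta₂_mul (x + w + τ) (x - w + τ) h2).mul_left _).congr_fun fun p => ?_
    simp only [Function.comp_apply, sumDiffEquiv_inr,
      jacobiTheta₂_term, ← Complex.exp_add]
    congr 1
    push_cast
    ring

lemma th3_sq (z : ℂ) {τ : ℂ} (hτ : 0 < τ.im) :
    th3 τ z ^ 2 = th3 (2 * τ) (2 * z) * th3 (2 * τ) 0 + th2 (2 * τ) (2 * z) * th2 (2 * τ) 0 := by
  simp only [th3_eq, th2_eq]
  rw [sq, jacobiTheta₂_mul_jacobiTheta₂ _ _ hτ,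
    show Complex.exp (Real.pi * I * (2 * z + τ)) = Complex.exp (Real.pi * I * (2 * τ / 4 + 2 * z)) *
      Complex.exp (Real.pi * I * (2 * τ / 4 + 0)) by rw [← Complex.exp_add]; ring_nf]
  ring_nf

lemma th4_sq (z : ℂ) {τ : ℂ} (hτ : 0 < τ.im) :
    th4 τ z ^ 2 = th3 (2 * τ) (2 * z) * th3 (2 * τ) 0 - th2 (2 * τ) (2 * z) * th2 (2 * τ) 0 := by
  simp only [th3_eq, th2_eq, th4_eq]
  rw [sq, jacobiTheta₂_mul_jacobiTheta₂ _ _ hτ,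
    show Complex.exp (Real.pi * I * (2 * (z + 1 / 2) + τ)) =
      - (Complex.exp (Real.pi * I * (2 * τ / 4 + 2 * z)) *
        Complex.exp (Real.pi * I * (2 * τ / 4 + 0))) by
      rw [← neg_one_mul, ← exp_pi_mul_I, ← Complex.exp_add, ← Complex.exp_add]; ring_nf,
    show z + 1 / 2 + (z + 1 / 2) = 2 * z + 1 by ring,
    show 2 * z + 1 + τ = 2 * z + τ + 1 by ring, jacobiTheta₂_add_left, jacobiTheta₂_add_left]
  ring_nf

lemma th2_sq (z : ℂ) {τ : ℂ} (hτ : 0 < τ.im) :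
    th2 τ z ^ 2 = th2 (2 * τ) (2 * z) * th3 (2 * τ) 0 + th3 (2 * τ) (2 * z) * th2 (2 * τ) 0 := by
  simp only [th3_eq, th2_eq]
  rw [mul_pow, sq (jacobiTheta₂ _ _), jacobiTheta₂_mul_jacobiTheta₂ _ _ hτ,
    show z + τ / 2 + (z + τ / 2) + τ = 2 * z + 2 * τ by ring, jacobiTheta₂_add_left',
    ← Complex.exp_nat_mul, mul_add]
  congr 1
  · ring_nf
  · simp only [← mul_assoc, ← Complex.exp_add]
    ring_nf

lemma th1_sq (z : ℂ) {τ : ℂ} (hτ : 0 < τ.im) :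
    th1 τ z ^ 2 = th3 (2 * τ) (2 * z) * th2 (2 * τ) 0 - th2 (2 * τ) (2 * z) * th3 (2 * τ) 0 := by
  simp only [th3_eq, th2_eq, th1_eq]
  rw [mul_pow, mul_pow, sq (jacobiTheta₂ _ _), jacobiTheta₂_mul_jacobiTheta₂ _ _ hτ,
    show z + 1 / 2 + τ / 2 + (z + 1 / 2 + τ / 2) + τ = 2 * z + 2 * τ + 1 by ring,
    show z + 1 / 2 + τ / 2 + (z + 1 / 2 + τ / 2) = 2 * z + τ + 1 by ring,
    jacobiTheta₂_add_left, jacobiTheta₂_add_left, jacobiTheta₂_add_left',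
    ← Complex.exp_nat_mul,
    show Complex.exp (Real.pi * I * (2 * (z + 1 / 2 + τ / 2) + τ)) =
      - Complex.exp (Real.pi * I * (2 * (z + τ / 2) + τ)) by
      rw [← neg_one_mul, ← exp_pi_mul_I, ← Complex.exp_add]; ring_nf,
    neg_sq, I_sq]
  have h₁ : Complex.exp ((2 : ℕ) * (Real.pi * I * (τ / 4 + z))) =
      Complex.exp (Real.pi * I * (2 * τ / 4 + 2 * z)) := by
    congr 1; push_cast; ring
  have h₂ : Complex.exp ((2 : ℕ) * (Real.pi * I * (τ / 4 + z))) *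
      Complex.exp (Real.pi * I * (2 * (z + τ / 2) + τ)) *
      Complex.exp (-(Real.pi * I * (2 * τ + 2 * (2 * z)))) =
      Complex.exp (Real.pi * I * (2 * τ / 4 + 0)) := by
    rw [← Complex.exp_add, ← Complex.exp_add]; congr 1; push_cast; ring
  rw [show z + 1 / 2 + τ / 2 - (z + 1 / 2 + τ / 2) = 0 by ring]
  simp only [zero_add, neg_mul]
  rw [← h₂, ← h₁, show 2 * τ / 2 = τ by ring]
  ring

/-! ### Theta constants -/

lemma th3_zero_sq {τ : ℂ} (hτ : 0 < τ.im) :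
    th3 τ 0 ^ 2 = th3 (2 * τ) 0 ^ 2 + th2 (2 * τ) 0 ^ 2 := by
  rw [th3_sq 0 hτ, mul_zero]
  ring

lemma th4_zero_sq {τ : ℂ} (hτ : 0 < τ.im) :
    th4 τ 0 ^ 2 = th3 (2 * τ) 0 ^ 2 - th2 (2 * τ) 0 ^ 2 := by
  rw [th4_sq 0 hτ, mul_zero]
  ring

lemma th2_zero_sq {τ : ℂ} (hτ : 0 < τ.im) :
    th2 τ 0 ^ 2 = 2 * (th2 (2 * τ) 0 * th3 (2 * τ) 0) := by
  rw [th2_sq 0 hτ, mul_zero]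
  ring

/-! ### Modular transformations of the theta constants -/

lemma exp_pi_mul_I_mul_sq (n : ℤ) : Complex.exp (Real.pi * I * (n : ℂ) ^ 2) = (-1) ^ n := by
  rw [show (Real.pi * I * (n : ℂ) ^ 2) = ((n ^ 2 : ℤ) : ℂ) * (Real.pi * I) by push_cast; ring,
    exp_int_mul_pi_mul_I]
  rcases Int.even_or_odd n with h | h
  · rw [h.neg_one_zpow, (h.pow_of_ne_zero two_ne_zero).neg_one_zpow]
  · rw [h.neg_one_zpow, h.pow.neg_one_zpow]

lemma th3_add_one (τ : ℂ) : th3 (τ + 1) 0 = th4 τ 0 := by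
  refine tsum_congr fun n => ?_
  rw [← exp_pi_mul_I_mul_sq, ← Complex.exp_add, twoPiI]
  congr 1
  ring

lemma th4_add_one (τ : ℂ) : th4 (τ + 1) 0 = th3 τ 0 := by
  refine tsum_congr fun n => ?_
  have h : (-1 : ℂ) ^ n * (-1) ^ n = 1 := by
    rw [← mul_zpow, neg_one_mul, neg_neg, one_zpow]
  rw [show twoPiI * ((n : ℂ) * 0 + (n : ℂ) ^ 2 / 2 * (τ + 1)) =
    Real.pi * I * (n : ℂ) ^ 2 + twoPiI * ((n : ℂ) * 0 + (n : ℂ) ^ 2 / 2 * τ) by rw [twoPiI]; ring,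
    Complex.exp_add, exp_pi_mul_I_mul_sq, ← mul_assoc, h, one_mul]

lemma th2_add_one (τ : ℂ) : th2 (τ + 1) 0 = Complex.exp (Real.pi * I / 4) * th2 τ 0 := by
  rw [th2, th2, ← tsum_mul_left]
  refine tsum_congr fun n => ?_
  have h : Complex.exp (Real.pi * I * (n : ℂ) ^ 2) * Complex.exp (n * (Real.pi * I)) = 1 := by
    rw [exp_pi_mul_I_mul_sq, exp_int_mul_pi_mul_I, ← mul_zpow, neg_one_mul, neg_neg, one_zpow]
  rw [← Complex.exp_add,
    show twoPiI * (((n : ℂ) + 1 / 2) * 0 + ((n : ℂ) + 1 / 2) ^ 2 / 2 * (τ + 1)) =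
    Real.pi * I * (n : ℂ) ^ 2 + n * (Real.pi * I) + (Real.pi * I / 4 +
      twoPiI * (((n : ℂ) + 1 / 2) * 0 + ((n : ℂ) + 1 / 2) ^ 2 / 2 * τ)) by rw [twoPiI]; ring,
    Complex.exp_add, Complex.exp_add (Real.pi * I * (n : ℂ) ^ 2), h, one_mul]

lemma neg_I_mul_cpow_half_pow_four (τ : ℂ) : ((-I * τ) ^ (1 / 2 : ℂ)) ^ 4 = -τ ^ 2 := by
  rw [← cpow_nat_mul, show ((4 : ℕ) : ℂ) * (1 / 2) = ((2 : ℕ) : ℂ) by push_cast; ring,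
    cpow_natCast, mul_pow, neg_sq, I_sq]
  ring

lemma neg_I_mul_cpow_half_ne_zero {τ : ℂ} (hτ : τ ≠ 0) : (-I * τ) ^ (1 / 2 : ℂ) ≠ 0 := by
  intro h
  have := neg_I_mul_cpow_half_pow_four τ
  rw [h] at this
  simp_all

lemma th3_neg_one_div {τ : ℂ} (hτ : τ ≠ 0) :
    th3 (-1 / τ) 0 = (-I * τ) ^ (1 / 2 : ℂ) * th3 τ 0 := by
  have := neg_I_mul_cpow_half_ne_zero hτ
  rw [th3_eq, th3_eq, jacobiTheta₂_functional_equation 0 τ]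
  simp only [ne_eq, OfNat.ofNat_ne_zero, not_false_eq_true, zero_pow, mul_zero, zero_div,
    Complex.exp_zero]
  field_simp

lemma th2_neg_one_div {τ : ℂ} (hτ : τ ≠ 0) :
    th2 (-1 / τ) 0 = (-I * τ) ^ (1 / 2 : ℂ) * th4 τ 0 := by
  have := neg_I_mul_cpow_half_ne_zero hτ
  rw [th2_eq, th4_eq, jacobiTheta₂_functional_equation (0 + 1 / 2) τ,
    show 0 + -1 / τ / 2 = -((0 + 1 / 2) / τ) by ring, jacobiTheta₂_neg_left,
    show Real.pi * I * (-1 / τ / 4 + 0) = -Real.pi * I * (0 + 1 / 2) ^ 2 / τ by ring]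
  field_simp

lemma th4_neg_one_div {τ : ℂ} (hτ : τ ≠ 0) :
    th4 (-1 / τ) 0 = (-I * τ) ^ (1 / 2 : ℂ) * th2 τ 0 := by
  have := neg_I_mul_cpow_half_ne_zero hτ
  rw [th2_eq, th4_eq, jacobiTheta₂_functional_equation (0 + τ / 2) τ,
    show (0 + τ / 2) / τ = 0 + 1 / 2 by field_simp; ring,
    show -Real.pi * I * (0 + τ / 2) ^ 2 / τ = -(Real.pi * I * (τ / 4 + 0)) by field_simp; ring,
    Complex.exp_neg]
  field_simp [Complex.exp_ne_zero]

lemma th3_pow_four_neg_one_div {τ : ℂ} (hτ : τ ≠ 0) :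
    th3 (-1 / τ) 0 ^ 4 = -τ ^ 2 * th3 τ 0 ^ 4 := by
  rw [th3_neg_one_div hτ, mul_pow, neg_I_mul_cpow_half_pow_four]

lemma th2_pow_four_neg_one_div {τ : ℂ} (hτ : τ ≠ 0) :
    th2 (-1 / τ) 0 ^ 4 = -τ ^ 2 * th4 τ 0 ^ 4 := by
  rw [th2_neg_one_div hτ, mul_pow, neg_I_mul_cpow_half_pow_four]

lemma th4_pow_four_neg_one_div {τ : ℂ} (hτ : τ ≠ 0) :
    th4 (-1 / τ) 0 ^ 4 = -τ ^ 2 * th2 τ 0 ^ 4 := by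
  rw [th4_neg_one_div hτ, mul_pow, neg_I_mul_cpow_half_pow_four]

lemma th2_pow_four_add_one (τ : ℂ) : th2 (τ + 1) 0 ^ 4 = -th2 τ 0 ^ 4 := by
  rw [th2_add_one, mul_pow, ← Complex.exp_nat_mul,
    show ((4 : ℕ) : ℂ) * (Real.pi * I / 4) = Real.pi * I by push_cast; ring, exp_pi_mul_I,
    neg_one_mul]

/-! ### Analytic properties of the theta constants -/

lemma differentiableAt_th3 {τ : ℂ} (hτ : 0 < τ.im) : DifferentiableAt ℂ (fun t => th3 t 0) τ := by
  simp only [th3_eq]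
  exact differentiableAt_jacobiTheta₂_snd _ hτ

lemma differentiableAt_th4 {τ : ℂ} (hτ : 0 < τ.im) : DifferentiableAt ℂ (fun t => th4 t 0) τ := by
  simp only [th4_eq]
  exact differentiableAt_jacobiTheta₂_snd _ hτ

lemma differentiableAt_th2 {τ : ℂ} (hτ : 0 < τ.im) : DifferentiableAt ℂ (fun t => th2 t 0) τ := by
  simp only [th2_eq]
  refine DifferentiableAt.mul (by fun_prop) ?_
  exact DifferentiableAt.comp (g := fun p : ℂ × ℂ => jacobiTheta₂ p.1 p.2)
    (f := fun t : ℂ => (0 + t / 2, t)) τ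
    (hasFDerivAt_jacobiTheta₂ (0 + τ / 2) hτ).differentiableAt (by fun_prop)

open Filter Topology

lemma tendsto_rexp_neg_mul_im {c : ℝ} (hc : 0 < c) :
    Tendsto (fun τ : ℂ => Real.exp (-(c * τ.im))) (comap Complex.im atTop) (𝓝 0) :=
  Real.tendsto_exp_neg_atTop_nhds_zero.comp (tendsto_comap.const_mul_atTop hc)

lemma tendsto_exp_mul_I_mul {c : ℝ} (hc : 0 < c) :
    Tendsto (fun τ : ℂ => Complex.exp (c * I * τ)) (comap Complex.im atTop) (𝓝 0) := by
  refine tendsto_zero_iff_norm_tendsto_zero.mpr ((tendsto_rexp_neg_mul_im hc).congr fun τ => ?_)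
  rw [Complex.norm_exp]
  simp

lemma tendsto_th3 : Tendsto (fun τ => th3 τ 0) (comap Complex.im atTop) (𝓝 1) := by
  have h : Tendsto (fun τ => jacobiTheta τ - 1) (comap Complex.im atTop) (𝓝 0) :=
    isBigO_at_im_infty_jacobiTheta_sub_one.trans_tendsto
      ((tendsto_rexp_neg_mul_im Real.pi_pos).congr fun τ => by rw [neg_mul])
  simpa [th3_eq, jacobiTheta_eq_jacobiTheta₂] using h.add_const 1

lemma tendsto_add_one_comap_im :
    Tendsto (fun τ : ℂ => τ + 1) (comap Complex.im atTop) (comap Complex.im atTop) :=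
  tendsto_comap_iff.mpr (tendsto_comap.congr fun τ => by simp)

lemma tendsto_th4 : Tendsto (fun τ => th4 τ 0) (comap Complex.im atTop) (𝓝 1) :=
  (tendsto_th3.comp tendsto_add_one_comap_im).congr th3_add_one

lemma tendsto_jacobiTheta₂_half :
    Tendsto (fun τ => jacobiTheta₂ (τ / 2) τ) (comap Complex.im atTop) (𝓝 2) := by
  have hterm (n : ℤ) (τ : ℂ) : ‖jacobiTheta₂_term n (τ / 2) τ‖ =
      Real.exp (-(Real.pi * (n ^ 2 + n : ℤ) * τ.im)) := by
    rw [norm_jacobiTheta₂_term]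
    congr 1
    simp
    ring
  have hnn (n : ℤ) : 0 ≤ n ^ 2 + n := by
    rcases le_or_gt 0 n with h | h <;> nlinarith
  have h2 : ∑' n : ℤ, (if n ∈ ({0, -1} : Finset ℤ) then (1 : ℂ) else 0) = 2 := by
    rw [tsum_eq_sum (s := {0, -1}) fun n hn => if_neg hn, Finset.sum_ite_mem, Finset.inter_self]
    norm_num
  refine (congrArg 𝓝 h2) ▸ tendsto_tsum_of_dominated_convergence
    (bound := fun n : ℤ => ‖jacobiTheta₂_term n (I / 2) I‖)
    (hasSum_jacobiTheta₂_term (I / 2) (τ := I) (by simp)).summable.norm (fun n => ?_) ?_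
  · split_ifs with hn
    · refine tendsto_const_nhds.congr fun τ => ?_
      have hn' : n = 0 ∨ n = -1 := by simpa using hn
      rcases hn' with rfl | rfl
      · simp [jacobiTheta₂_term]
      · rw [jacobiTheta₂_term, ← Complex.exp_zero]
        congr 1
        push_cast
        ring
    · have hpos : 0 < n ^ 2 + n := by
        have hn' : n ≠ 0 ∧ n ≠ -1 := by simpa using hn
        refine lt_of_le_of_ne (hnn n) fun h => ?_
        have : n * (n + 1) = 0 := by linarith
        rcases mul_eq_zero.mp this with h | h <;> omega
      refine tendsto_zero_iff_norm_tendsto_zero.mpr ?_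
      simp only [hterm]
      exact tendsto_rexp_neg_mul_im (mul_pos Real.pi_pos (by exact_mod_cast hpos))
  · filter_upwards [tendsto_comap.eventually (eventually_ge_atTop (1 : ℝ))] with τ hτ n
    rw [hterm, hterm]
    have h0 : (0 : ℝ) ≤ Real.pi * (n ^ 2 + n : ℤ) :=
      mul_nonneg Real.pi_pos.le (by exact_mod_cast hnn n)
    simp only [I_im]
    gcongr

lemma tendsto_th2 : Tendsto (fun τ => th2 τ 0) (comap Complex.im atTop) (𝓝 0) := by
  have h := (tendsto_exp_mul_I_mul (c := Real.pi / 4) (by positivity)).mul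
    tendsto_jacobiTheta₂_half
  rw [zero_mul] at h
  refine h.congr fun τ => ?_
  rw [th2_eq]
  push_cast
  ring_nf

/-! ### The Eisenstein series `E₂` -/

lemma qq_add_one (τ : ℂ) : qq (τ + 1) = qq τ := by
  rw [qq, qq, twoPiI, mul_add, mul_one, Complex.exp_add, exp_two_pi_mul_I, mul_one]

lemma E2_add_one (τ : ℂ) : E2 (τ + 1) = E2 τ := by
  rw [E2, E2, qq_add_one]

lemma sum_divisors_eq_sigma (n : ℕ) :
    ∑ d ∈ Nat.divisors n, (d : ℂ) = (ArithmeticFunction.sigma 1 n : ℂ) := by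
  rw [ArithmeticFunction.sigma_one_apply]
  push_cast
  rfl

lemma E2_coe (τ : UpperHalfPlane) : E2 τ = EisensteinSeries.E2 τ := by
  rw [EisensteinSeries.E2_eq_tsum_cexp,
    tsum_pnat_eq_tsum_succ (f := fun n => (ArithmeticFunction.sigma 1 n : ℂ) *
      Complex.exp (2 * Real.pi * I * τ) ^ n), E2]
  simp only [sum_divisors_eq_sigma, qq, twoPiI]

lemma tendsto_qq : Tendsto qq (comap Complex.im atTop) (𝓝 0) := by
  refine (tendsto_exp_mul_I_mul (c := 2 * Real.pi) (by positivity)).congr fun τ => ?_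
  rw [qq, twoPiI]
  push_cast
  rfl

lemma summable_E2_term {τ : ℂ} (hτ : 0 < τ.im) :
    Summable fun n : ℕ => (∑ d ∈ Nat.divisors (n + 1), (d : ℂ)) * qq τ ^ (n + 1) := by
  have h := (summable_nat_add_iff 1).mpr
    (EisensteinSeries.summable_sigma_mul_cexp_pow (k := 2) one_le_two ⟨τ, hτ⟩)
  refine h.congr fun n => ?_
  simp [sum_divisors_eq_sigma, qq, twoPiI]

lemma norm_qq (τ : ℂ) : ‖qq τ‖ = Real.exp (-(2 * Real.pi * τ.im)) := by
  rw [qq, twoPiI, Complex.norm_exp]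
  simp

lemma tendsto_E2 : Tendsto E2 (comap Complex.im atTop) (𝓝 1) := by
  have h : Tendsto (fun τ => ∑' n : ℕ, (∑ d ∈ Nat.divisors (n + 1), (d : ℂ)) * qq τ ^ (n + 1))
      (comap Complex.im atTop) (𝓝 (∑' _ : ℕ, 0)) := by
    refine tendsto_tsum_of_dominated_convergence
      (summable_E2_term (τ := I) (by simp)).norm (fun n => ?_) ?_
    · simpa using (tendsto_qq.pow (n + 1)).const_mul (∑ d ∈ Nat.divisors (n + 1), (d : ℂ))
    · filter_upwards [tendsto_comap.eventually (eventually_ge_atTop (1 : ℝ))] with τ hτ n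
      rw [norm_mul, norm_mul, norm_pow, norm_pow, norm_qq, norm_qq, I_im]
      gcongr
  have h' := (h.const_mul 24).const_sub 1
  rwa [tsum_zero, mul_zero, sub_zero] at h'

lemma differentiableAt_E2 {τ : ℂ} (hτ : 0 < τ.im) : DifferentiableAt ℂ E2 τ := by
  have h := UpperHalfPlane.mdifferentiable_iff.mp E2_mdifferentiable
  refine (h.differentiableAt
    (UpperHalfPlane.isOpen_upperHalfPlaneSet.mem_nhds hτ)).congr_of_eventuallyEq ?_
  filter_upwards [UpperHalfPlane.isOpen_upperHalfPlaneSet.mem_nhds hτ] with t ht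
  rw [Function.comp_apply, UpperHalfPlane.ofComplex_apply_of_im_pos ht, ← E2_coe]

lemma E2_neg_one_div {τ : ℂ} (hτ : 0 < τ.im) :
    E2 (-1 / τ) = τ ^ 2 * E2 τ + 6 * τ / (Real.pi * I) := by
  have hτ0 : τ ≠ 0 := fun h => by simp [h] at hτ
  have h := congrFun (EisensteinSeries.E2_slash_action ModularGroup.S) ⟨τ, hτ⟩
  rw [ModularForm.SL_slash_apply, UpperHalfPlane.modular_S_smul, ← E2_coe, Pi.sub_apply,
    Pi.smul_apply, EisensteinSeries.D2_S, ← E2_coe, ModularGroup.denom_S] at h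
  simp [riemannZeta_two] at h
  rw [neg_div, one_div]
  have h' : E2 (-τ⁻¹) = (E2 τ - 6 / Real.pi ^ 2 * 2⁻¹ * (2 * Real.pi * I / τ)) * τ ^ 2 := by
    rw [← h]
    field_simp
  rw [h']
  have hpi : (Real.pi : ℂ) ≠ 0 := by exact_mod_cast Real.pi_ne_zero
  field_simp
  ring_nf
  simp
  ring

/-! ### Level one cusp forms from functions on the upper half-plane -/

open scoped MatrixGroups ModularForm in
lemma exists_cuspForm {k : ℕ} {f : ℂ → ℂ} (hd : ∀ τ : ℂ, 0 < τ.im → DifferentiableAt ℂ f τ)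
    (hS : ∀ τ : ℂ, 0 < τ.im → f (-1 / τ) = τ ^ k * f τ)
    (hT : ∀ τ : ℂ, 0 < τ.im → f (τ + 1) = f τ)
    (h0 : Tendsto f (comap Complex.im atTop) (𝓝 0)) :
    ∃ F : CuspForm 𝒮ℒ k, ∀ τ : UpperHalfPlane, F τ = f τ := by
  have hS' : ((fun τ : UpperHalfPlane => f τ) ∣[(k : ℤ)] ModularGroup.S) =
      fun τ : UpperHalfPlane => f τ := by
    ext τ
    rw [ModularForm.SL_slash_apply, UpperHalfPlane.modular_S_smul, ModularGroup.denom_S]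
    have h := hS τ τ.im_pos
    have hτ := UpperHalfPlane.ne_zero τ
    rw [neg_div, one_div] at h
    simp only [inv_neg, h, zpow_neg, zpow_natCast]
    field_simp
  have hT' : ((fun τ : UpperHalfPlane => f τ) ∣[(k : ℤ)] ModularGroup.T) =
      fun τ : UpperHalfPlane => f τ := by
    ext τ
    rw [ModularForm.SL_slash_apply, UpperHalfPlane.modular_T_smul, ModularGroup.denom_apply]
    have h := hT τ τ.im_pos
    simp [ModularGroup.T, add_comm (1 : ℂ), h]
  have hz : UpperHalfPlane.IsZeroAtImInfty fun τ : UpperHalfPlane => f τ :=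
    h0.comp UpperHalfPlane.tendsto_coe_atImInfty
  refine ⟨{
    toFun := fun τ => f τ
    slash_action_eq' := ?_
    holo' := ?_
    zero_at_cusps' := ?_ }, fun τ => rfl⟩
  · rintro A ⟨A, rfl⟩
    exact SlashInvariantForm.slash_action_generators_SL2Z hS' hT' A
  · rw [UpperHalfPlane.mdifferentiable_iff]
    refine DifferentiableOn.congr (fun z hz => (hd z hz).differentiableWithinAt) fun z hz => ?_
    simp [UpperHalfPlane.ofComplex_apply_of_im_pos hz]
  · intro c hc
    rw [Subgroup.IsArithmetic.isCusp_iff_isCusp_SL2Z] at hc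
    rw [OnePoint.isZeroAt_iff_forall_SL2Z hc]
    intro γ _
    rw [SlashInvariantForm.slash_action_generators_SL2Z hS' hT']
    exact hz

/-! ### The weight two identity -/

lemma neg_one_div_im_pos {τ : ℂ} (hτ : 0 < τ.im) : 0 < (-1 / τ).im := by
  have h0 : τ ≠ 0 := fun h => by simp [h] at hτ
  rw [neg_div, one_div, neg_im, inv_im, neg_div, neg_neg]
  exact div_pos hτ (normSq_pos.mpr h0)

/-- The difference of the two sides of the weight two identity for `ϑ₂` and `ϑ₃`. -/
def defect₄ (τ : ℂ) : ℂ := 2 * E2 τ - E2 (τ / 2) - (th2 τ 0 ^ 4 + th3 τ 0 ^ 4)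

/-- The difference of the two sides of the weight two identity for `ϑ₂` and `ϑ₄`. -/
def defect₃ (τ : ℂ) : ℂ := 2 * E2 τ - E2 ((τ + 1) / 2) - (th4 τ 0 ^ 4 - th2 τ 0 ^ 4)

/-- The difference of the two sides of the weight two identity for `ϑ₃` and `ϑ₄`. -/
def defect₂ (τ : ℂ) : ℂ := 2 * E2 τ - 4 * E2 (2 * τ) + (th3 τ 0 ^ 4 + th4 τ 0 ^ 4)

lemma defect₄_add_one (τ : ℂ) : defect₄ (τ + 1) = defect₃ τ := by
  rw [defect₄, defect₃, E2_add_one, th2_pow_four_add_one, th3_add_one]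
  ring

lemma defect₃_add_one (τ : ℂ) : defect₃ (τ + 1) = defect₄ τ := by
  rw [defect₄, defect₃, E2_add_one, th2_pow_four_add_one, th4_add_one,
    show (τ + 1 + 1) / 2 = τ / 2 + 1 by ring, E2_add_one]
  ring

lemma defect₂_add_one (τ : ℂ) : defect₂ (τ + 1) = defect₂ τ := by
  rw [defect₂, defect₂, E2_add_one, th3_add_one, th4_add_one,
    show 2 * (τ + 1) = 2 * τ + 1 + 1 by ring, E2_add_one, E2_add_one]
  ring

lemma defect₄_neg_one_div {τ : ℂ} (hτ : 0 < τ.im) : defect₄ (-1 / τ) = τ ^ 2 * defect₂ τ := by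
  have h0 : τ ≠ 0 := fun h => by simp [h] at hτ
  rw [defect₄, defect₂, E2_neg_one_div hτ, th2_pow_four_neg_one_div h0,
    th3_pow_four_neg_one_div h0, show -1 / τ / 2 = -1 / (2 * τ) by field_simp,
    E2_neg_one_div (by simpa using hτ)]
  ring

lemma defect₂_neg_one_div {τ : ℂ} (hτ : 0 < τ.im) : defect₂ (-1 / τ) = τ ^ 2 * defect₄ τ := by
  have h0 : τ ≠ 0 := fun h => by simp [h] at hτ
  rw [defect₄, defect₂, E2_neg_one_div hτ, th4_pow_four_neg_one_div h0,
    th3_pow_four_neg_one_div h0, show 2 * (-1 / τ) = -1 / (τ / 2) by field_simp,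
    E2_neg_one_div (by simpa using hτ)]
  ring

lemma E2_half_neg_one_div_add_one {τ : ℂ} (hτ : 0 < τ.im) :
    E2 ((-1 / τ + 1) / 2) = τ ^ 2 * E2 ((τ + 1) / 2) + 12 * τ / (Real.pi * I) := by
  have h0 : τ ≠ 0 := fun h => by simp [h] at hτ
  have h1 : τ - 1 ≠ 0 := fun h => by
    have := congrArg Complex.im h
    simp at this
    exact hτ.ne' this
  have hpi : (Real.pi : ℂ) ≠ 0 := by exact_mod_cast Real.pi_ne_zero
  have hu : 0 < ((τ - 1) / 2).im := by simpa using hτ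
  have hv : 0 < (-1 / ((τ - 1) / 2) - 1 - 1).im := by
    simpa using neg_one_div_im_pos hu
  have hT (t : ℂ) : E2 (t - 1) = E2 t := by rw [← E2_add_one, sub_add_cancel]
  rw [show (-1 / τ + 1) / 2 = -1 / (-1 / ((τ - 1) / 2) - 1 - 1) by
      have : -1 / ((τ - 1) / 2) - 1 - 1 = -2 * τ / (τ - 1) := by field_simp; ring
      rw [this]; field_simp; ring,
    E2_neg_one_div hv, hT, hT, E2_neg_one_div hu,
    show (τ - 1) / 2 = (τ + 1) / 2 - 1 by ring, hT]
  have : -1 / ((τ + 1) / 2 - 1) - 1 - 1 = -2 * τ / (τ - 1) := by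
    rw [show (τ + 1) / 2 - 1 = (τ - 1) / 2 by ring]; field_simp; ring
  rw [this]
  field_simp
  ring

lemma defect₃_neg_one_div {τ : ℂ} (hτ : 0 < τ.im) : defect₃ (-1 / τ) = τ ^ 2 * defect₃ τ := by
  have h0 : τ ≠ 0 := fun h => by simp [h] at hτ
  rw [defect₃, defect₃, E2_neg_one_div hτ, th4_pow_four_neg_one_div h0,
    th2_pow_four_neg_one_div h0, E2_half_neg_one_div_add_one hτ]
  ring

lemma differentiableAt_defect₄ {τ : ℂ} (hτ : 0 < τ.im) : DifferentiableAt ℂ defect₄ τ := by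
  have := differentiableAt_th2 hτ
  have := differentiableAt_th3 hτ
  have := differentiableAt_E2 hτ
  have : DifferentiableAt ℂ (fun t => E2 (t / 2)) τ :=
    (differentiableAt_E2 (τ := τ / 2) (by simpa using hτ)).fun_comp' τ (by fun_prop)
  unfold defect₄
  fun_prop

lemma differentiableAt_defect₃ {τ : ℂ} (hτ : 0 < τ.im) : DifferentiableAt ℂ defect₃ τ := by
  simp only [← funext defect₄_add_one]
  exact (differentiableAt_defect₄ (τ := τ + 1) (by simpa using hτ)).fun_comp' τ (by fun_prop)

lemma differentiableAt_defect₂ {τ : ℂ} (hτ : 0 < τ.im) : DifferentiableAt ℂ defect₂ τ := by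
  have := differentiableAt_th4 hτ
  have := differentiableAt_th3 hτ
  have := differentiableAt_E2 hτ
  have : DifferentiableAt ℂ (fun t => E2 (2 * t)) τ :=
    (differentiableAt_E2 (τ := 2 * τ) (by simpa using hτ)).fun_comp' τ (by fun_prop)
  unfold defect₂
  fun_prop

lemma tendsto_defect₄ : Tendsto defect₄ (comap Complex.im atTop) (𝓝 0) := by
  have h : Tendsto (fun τ : ℂ => τ / 2) (comap Complex.im atTop) (comap Complex.im atTop) :=
    tendsto_comap_iff.mpr ((tendsto_comap.atTop_div_const (two_pos)).congr fun τ => by simp)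
  have := ((tendsto_E2.const_mul 2).sub (tendsto_E2.comp h)).sub
    ((tendsto_th2.pow 4).add (tendsto_th3.pow 4))
  norm_num at this
  exact this

lemma tendsto_defect₃ : Tendsto defect₃ (comap Complex.im atTop) (𝓝 0) :=
  (tendsto_defect₄.comp tendsto_add_one_comap_im).congr defect₄_add_one

lemma tendsto_defect₂ : Tendsto defect₂ (comap Complex.im atTop) (𝓝 0) := by
  have h : Tendsto (fun τ : ℂ => 2 * τ) (comap Complex.im atTop) (comap Complex.im atTop) :=
    tendsto_comap_iff.mpr ((tendsto_comap.const_mul_atTop (two_pos)).congr fun τ => by simp)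
  have := ((tendsto_E2.const_mul 2).sub ((tendsto_E2.comp h).const_mul 4)).add
    ((tendsto_th3.pow 4).add (tendsto_th4.pow 4))
  norm_num at this
  exact this

lemma defect_mul_eq_zero {τ : ℂ} (hτ : 0 < τ.im) : defect₄ τ * (defect₃ τ * defect₂ τ) = 0 := by
  obtain ⟨F, hF⟩ := exists_cuspForm (k := 6) (f := fun τ => defect₄ τ * (defect₃ τ * defect₂ τ))
    (fun τ hτ => (differentiableAt_defect₄ hτ).mul
      ((differentiableAt_defect₃ hτ).mul (differentiableAt_defect₂ hτ)))
    (fun τ hτ => by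
      rw [defect₄_neg_one_div hτ, defect₃_neg_one_div hτ, defect₂_neg_one_div hτ]; ring)
    (fun τ _ => by rw [defect₄_add_one, defect₃_add_one, defect₂_add_one]; ring)
    (by simpa using tendsto_defect₄.mul (tendsto_defect₃.mul tendsto_defect₂))
  have h0 : F = 0 := rank_zero_iff_forall_zero.mp
    (CuspForm.rank_eq_zero_of_weight_lt_twelve (by norm_num)) F
  have := hF ⟨τ, hτ⟩
  rw [h0] at this
  exact this.symm

lemma defect₄_eq_zero {τ : ℂ} (hτ : 0 < τ.im) : defect₄ τ = 0 := by
  have han {f : ℂ → ℂ} (hf : ∀ {τ : ℂ}, 0 < τ.im → DifferentiableAt ℂ f τ) :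
      AnalyticOnNhd ℂ f UpperHalfPlane.upperHalfPlaneSet :=
    DifferentiableOn.analyticOnNhd (fun z hz => (hf hz).differentiableWithinAt)
      UpperHalfPlane.isOpen_upperHalfPlaneSet
  have hconn : IsPreconnected UpperHalfPlane.upperHalfPlaneSet :=
    (convex_halfSpace_im_gt 0).isPreconnected
  rcases AnalyticOnNhd.eq_zero_or_eq_zero_of_mul_eq_zero (han differentiableAt_defect₄)
    ((han differentiableAt_defect₃).mul (han differentiableAt_defect₂))
    (fun z hz => defect_mul_eq_zero hz) hconn with h | h
  · exact h τ hτ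
  rcases AnalyticOnNhd.eq_zero_or_eq_zero_of_mul_eq_zero (han differentiableAt_defect₃)
    (han differentiableAt_defect₂) h hconn with h | h
  · rw [← defect₃_add_one]
    exact h (τ + 1) (by simpa [UpperHalfPlane.upperHalfPlaneSet] using hτ)
  · have h0 : τ ≠ 0 := fun h => by simp [h] at hτ
    have h' := defect₂_neg_one_div hτ
    rw [h _ (neg_one_div_im_pos hτ)] at h'
    exact (mul_eq_zero.mp h'.symm).resolve_left (pow_ne_zero 2 h0)

/-- `2 E₂(τ) - E₂(τ/2) = ϑ₂(τ,0)⁴ + ϑ₃(τ,0)⁴`. -/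
lemma two_mul_E2_sub {τ : ℂ} (hτ : 0 < τ.im) :
    2 * E2 τ - E2 (τ / 2) = th2 τ 0 ^ 4 + th3 τ 0 ^ 4 :=
  sub_eq_zero.mp (defect₄_eq_zero hτ)

/-! ### The product of the theta constants -/

lemma etaF_eq (τ : ℂ) : etaF τ = ModularForm.eta τ := by
  rw [etaF, ModularForm.eta]
  simp only [ModularForm.eta_q_eq_pow, qq, twoPiI, Function.Periodic.qParam]
  norm_num

lemma etaF_ne_zero {τ : ℂ} (hτ : 0 < τ.im) : etaF τ ≠ 0 := by
  rw [etaF_eq]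
  exact ModularForm.eta_ne_zero hτ

lemma differentiableAt_etaF {τ : ℂ} (hτ : 0 < τ.im) : DifferentiableAt ℂ etaF τ := by
  rw [funext etaF_eq]
  exact ModularForm.differentiableAt_eta_of_mem_upperHalfPlaneSet hτ

lemma tendsto_tprod_one_sub_qq :
    Tendsto (fun τ => ∏' n : ℕ, (1 - qq τ ^ (n + 1))) (comap Complex.im atTop) (𝓝 1) := by
  have h : Tendsto (fun q : ℂ => ∏' n : ℕ, (1 + -q ^ (n + 1))) (𝓝 0) (𝓝 (∏' _ : ℕ, (1 + 0))) := by
    refine tendsto_tprod_one_add_of_dominated_convergence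
      (bound := fun n => (1 / 2 : ℝ) ^ (n + 1)) ?_ (fun n => ?_) ?_
    · exact (summable_nat_add_iff 1).mpr (summable_geometric_of_abs_lt_one (by norm_num))
    · simpa using ((continuous_pow (M := ℂ) (n + 1)).tendsto 0).neg
    · filter_upwards [Metric.ball_mem_nhds (0 : ℂ) (by norm_num : (0 : ℝ) < 1 / 2)] with q hq n
      rw [norm_neg, norm_pow]
      exact pow_le_pow_left₀ (norm_nonneg _) (mem_ball_zero_iff.mp hq).le _
  have hlim := h.comp tendsto_qq
  simp only [add_zero, tprod_one, ← sub_eq_add_neg] at hlim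
  exact hlim

/-- The quotient of `(ϑ₂ϑ₃ϑ₄)²` by `η⁶`. -/
def thetaRatio (τ : ℂ) : ℂ := (th2 τ 0 * th3 τ 0 * th4 τ 0) ^ 2 / etaF τ ^ 6

lemma thetaRatio_eq (τ : ℂ) : thetaRatio τ =
    (jacobiTheta₂ (τ / 2) τ * th3 τ 0 * th4 τ 0) ^ 2 / (∏' n : ℕ, (1 - qq τ ^ (n + 1))) ^ 6 := by
  have h : Complex.exp (twoPiI * τ / 24) ^ 6 = Complex.exp (Real.pi * I * (τ / 4 + 0)) ^ 2 := by
    rw [← Complex.exp_nat_mul, ← Complex.exp_nat_mul, twoPiI]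
    congr 1
    push_cast
    ring
  rw [thetaRatio, etaF, mul_pow _ _ 6, h, th2_eq, zero_add, mul_assoc, mul_assoc, mul_pow,
    mul_div_mul_left _ _ (pow_ne_zero 2 (Complex.exp_ne_zero _)), mul_assoc]

lemma tendsto_thetaRatio : Tendsto thetaRatio (comap Complex.im atTop) (𝓝 4) := by
  simp only [funext thetaRatio_eq]
  have h := (((tendsto_jacobiTheta₂_half.mul tendsto_th3).mul tendsto_th4).pow 2).div
    (tendsto_tprod_one_sub_qq.pow 6) (by norm_num)
  norm_num at h
  exact h

lemma differentiableAt_thetaRatio {τ : ℂ} (hτ : 0 < τ.im) : DifferentiableAt ℂ thetaRatio τ :=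
  ((((differentiableAt_th2 hτ).mul (differentiableAt_th3 hτ)).mul (differentiableAt_th4 hτ)).pow
    2).div ((differentiableAt_etaF hτ).pow 6) (pow_ne_zero 6 (etaF_ne_zero hτ))

lemma exists_thetaRatio_pow_four_eq :
    ∃ c : ℂ, ∀ τ : ℂ, 0 < τ.im → thetaRatio τ ^ 4 = c := by
  obtain ⟨F, hF⟩ := exists_cuspForm (k := 12) (f := fun τ => (th2 τ 0 * th3 τ 0 * th4 τ 0) ^ 8)
    (fun τ hτ => (((differentiableAt_th2 hτ).mul (differentiableAt_th3 hτ)).mul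
      (differentiableAt_th4 hτ)).pow 8)
    (fun τ hτ => by
      have h0 : τ ≠ 0 := fun h => by simp [h] at hτ
      have (a b c : ℂ) : (a * b * c) ^ 8 = (a ^ 4 * b ^ 4 * c ^ 4) ^ 2 := by ring
      rw [this, th2_pow_four_neg_one_div h0, th3_pow_four_neg_one_div h0,
        th4_pow_four_neg_one_div h0]
      ring)
    (fun τ _ => by
      have (a b c : ℂ) : (a * b * c) ^ 8 = (a ^ 4 * b ^ 4 * c ^ 4) ^ 2 := by ring
      rw [this, th2_pow_four_add_one, th3_add_one, th4_add_one]
      ring)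
    (by simpa using ((tendsto_th2.mul tendsto_th3).mul tendsto_th4).pow 8)
  obtain ⟨c, hc⟩ := CuspForm.exists_smul_discriminant_of_weight_eq_twelve F
  refine ⟨c, fun τ hτ => ?_⟩
  have h := hF ⟨τ, hτ⟩
  have hη := etaF_ne_zero hτ
  rw [← hc, _root_.smul_apply, CuspForm.coe_discriminant, ModularForm.discriminant, ← etaF_eq,
    smul_eq_mul] at h
  rw [thetaRatio, div_pow, div_eq_iff (by positivity)]
  linear_combination -h

/-- `(ϑ₂(τ,0) ϑ₃(τ,0) ϑ₄(τ,0))² = 4 η(τ)⁶`. -/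
lemma theta_mul_sq_eq {τ : ℂ} (hτ : 0 < τ.im) :
    (th2 τ 0 * th3 τ 0 * th4 τ 0) ^ 2 = 4 * etaF τ ^ 6 := by
  obtain ⟨c, hc⟩ := exists_thetaRatio_pow_four_eq
  have hconst (t : ℂ) (ht : 0 < t.im) : thetaRatio t = thetaRatio τ := by
    refine IsPreconnected.constant_of_mapsTo (S := UpperHalfPlane.upperHalfPlaneSet)
      (T := ((Polynomial.nthRoots 4 c).toFinset : Set ℂ)) (convex_halfSpace_im_gt 0).isPreconnected
      (Set.Finite.isDiscrete (Finset.finite_toSet _))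
      (fun z hz => (differentiableAt_thetaRatio hz).continuousAt.continuousWithinAt)
      (fun z hz => ?_) ht hτ
    simpa [Polynomial.mem_nthRoots] using hc z hz
  have hlim : Tendsto thetaRatio (comap Complex.im atTop) (𝓝 (thetaRatio τ)) := by
    refine tendsto_const_nhds.congr' ?_
    filter_upwards [tendsto_comap.eventually (eventually_gt_atTop (0 : ℝ))] with t ht
    exact (hconst t ht).symm
  have hbot : (comap Complex.im atTop).NeBot :=
    comap_neBot_iff_frequently.mpr (Eventually.frequently (.of_forall fun y => ⟨y * I, by simp⟩))
  have h := tendsto_nhds_unique hlim tendsto_thetaRatio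
  rwa [thetaRatio, div_eq_iff (pow_ne_zero 6 (etaF_ne_zero hτ))] at h

/-- `(1/12)·φ_{0,1}(τ,z) − Λ₂(τ/2)·φ_{-2,1}(τ,z) = ϑ₄(τ,z)²/ϑ₄(τ,0)²`. -/
theorem theta4_identity :
    ∀ τ z : ℂ, 0 < τ.im →
      1 / 12 * phi01 τ z - Lam 2 (τ / 2) * phim21 τ z = th4 τ z ^ 2 / th4 τ 0 ^ 2 := by
  intro τ z hτ
  have hprod := theta_mul_sq_eq hτ
  have hE := two_mul_E2_sub hτ
  have hη := etaF_ne_zero hτ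
  have hne : (th2 τ 0 * th3 τ 0 * th4 τ 0) ^ 2 ≠ 0 := by
    rw [hprod]
    exact mul_ne_zero (by norm_num) (pow_ne_zero 6 hη)
  have hLam : Lam 2 (τ / 2) =
      ((th2 τ 0 ^ 2) ^ 2 + (th3 τ 0 ^ 2) ^ 2) / 12 := by
    rw [Lam, Nat.cast_ofNat, mul_div_cancel₀ τ two_ne_zero, hE]
    ring
  have hη6 : etaF τ ^ 6 = th2 τ 0 ^ 2 * th3 τ 0 ^ 2 * th4 τ 0 ^ 2 / 4 := by
    rw [← mul_pow, ← mul_pow, hprod]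
    ring
  rw [mul_pow, mul_pow] at hne
  rw [phi01, phim21, hLam, hη6, th1_sq z hτ, th2_sq z hτ, th3_sq z hτ, th4_sq z hτ]
  rw [th2_zero_sq hτ, th3_zero_sq hτ, th4_zero_sq hτ] at hne ⊢
  generalize th3 (2 * τ) 0 = a at hne ⊢
  generalize th2 (2 * τ) 0 = b at hne ⊢
  obtain ⟨⟨hba, h3⟩, h4⟩ : ((b ≠ 0 ∧ a ≠ 0) ∧ a ^ 2 + b ^ 2 ≠ 0) ∧ a ^ 2 - b ^ 2 ≠ 0 := by
    simpa only [mul_ne_zero_iff, ne_eq, two_ne_zero, not_false_eq_true, true_and] using hne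
  obtain ⟨hb, ha⟩ := hba
  field_simp
  ring
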